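/- Let N ∈ ℕ and for each k ∈ ℕ set h_k = inf { H(G_k(ξ)) : ξ ∈ ℓ²(F_∞^k), ‖ξ‖ = 1 }, where G_k(ξ) is the positive semidefinite Hermitian matrix indexed by v,w ∈ {1,…,N}^k with entries G_k(ξ)_{vw} = N^{-k}⟨U_w ξ, U_v ξ⟩ and H denotes von Neumann entropy. Then liminf_{k→∞} h_k / k ≥ log N − log(1 + 9/N) ≥ log N − 9/N. In particular, the regularized minimum output entropy of Φ_N satisfies H̄_min(Φ_N) ≥ log N − log(1 + 9/N). -/

import Mathlib

open scoped ENNReal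
open Filter

noncomputable section

/-- The free group on countably many generators. -/
abbrev FG : Type := FreeGroup ℕ

/-- The generators `g_i` of the free group. -/
def gen (i : ℕ) : FG := FreeGroup.of i

/-- `ℓ²(F_∞^k)`. -/
abbrev l2 (k : ℕ) : Type := lp (fun _ : Fin k → FG => ℂ) 2

/-- The inner product `⟨U_w ξ, U_v ξ⟩ = Σ_x conj((U_w ξ)(x)) (U_v ξ)(x)`, where
`(U_v ξ)(x) = ξ(g_{v_1}^{-1}x_1, …, g_{v_k}^{-1}x_k)`. -/
def innerUU {N k : ℕ} (ξ : l2 k) (w v : Fin k → Fin N) : ℂ :=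
  ∑' x : Fin k → FG,
    (starRingEnd ℂ) (ξ (fun j => (gen (w j : ℕ))⁻¹ * x j)) *
      ξ (fun j => (gen (v j : ℕ))⁻¹ * x j)

/-- The Gram-type matrix `G_k(ξ)_{vw} = N^{-k}⟨U_w ξ, U_v ξ⟩`, i.e. the output of the
complementary channel of `Φ_N^{⊗k}` at the pure state `|ξ⟩⟨ξ|`. -/
def Gmat (N k : ℕ) (ξ : l2 k) : Matrix (Fin k → Fin N) (Fin k → Fin N) ℂ :=
  Matrix.of fun v w => ((N : ℂ) ^ k)⁻¹ * innerUU ξ w v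

/-- The von Neumann entropy of a (Hermitian) matrix: `H(M) = −Σ_i λ_i log λ_i`, where
the `λ_i` are the eigenvalues of `M` (junk value `0` for non-Hermitian matrices). -/
def vnEntropy {n : Type*} [Fintype n] [DecidableEq n] (M : Matrix n n ℂ) : ℝ :=
  if h : M.IsHermitian then ∑ i, Real.negMulLog (h.eigenvalues i) else 0

/-- `h_k = H_min(Φ_N^{⊗k})`, the minimum output entropy of the `k`-fold tensor power of
`Φ_N`, realized as the infimum of entropies of complementary-channel outputs `G_k(ξ)`
over unit vectors `ξ`. -/
def minOutEntropy (N k : ℕ) : ℝ :=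
  sInf {x : ℝ | ∃ ξ : l2 k, ‖ξ‖ = 1 ∧ x = vnEntropy (Gmat N k ξ)}

section Combinatorics

lemma head?_toWord_gen_mul (i : ℕ) (y : FG)
    (h : (gen i * y).toWord.head? ≠ some (i, true)) :
    y.toWord.head? = some (i, false) := by
  have hw : (gen i * y).toWord = FreeGroup.reduce ((i, true) :: y.toWord) := by
    simp [gen, FreeGroup.toWord_mul]
  rw [hw, FreeGroup.reduce.cons, FreeGroup.reduce_toWord] at h
  cases hy : y.toWord with
  | nil => simp [hy] at h
  | cons a L =>
    obtain ⟨j, b⟩ := a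
    rw [hy] at h
    by_cases hc : i = j ∧ true = !b
    · obtain ⟨rfl, hb⟩ := hc
      cases b
      · rfl
      · cases hb
    · dsimp only at h
      rw [if_neg hc] at h
      exact absurd rfl h

/-- The cancellation type of `x` with respect to the pair of generators `g_i, g_j`: for `i ≠ j`
it records whether the reduced word of `x` starts with `g_i`, with `g_j`, or with neither. -/
def cancelType (i j : ℕ) (x : FG) : Fin 3 :=
  if i = j then 0
  else if x.toWord.head? = some (i, true) then 0
  else if x.toWord.head? = some (j, true) then 1
  else 2

lemma cancelType_self (i : ℕ) (x : FG) : cancelType i i x = 0 := by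
  simp [cancelType]

/-- The pairs `i ≠ j` with `cancelType i j (g_i y) = cancelType i j (g_j z)` are determined by the
common value. -/
lemma eq_of_cancelType_eq {y z : FG} {i j i' j' : ℕ} (hij : i ≠ j) (hij' : i' ≠ j')
    (h : cancelType i j (gen i * y) = cancelType i j (gen j * z))
    (h' : cancelType i' j' (gen i' * y) = cancelType i' j' (gen j' * z))
    (hh : cancelType i j (gen i * y) = cancelType i' j' (gen i' * y)) :
    i = i' ∧ j = j' := by
  have a := or_iff_not_imp_left.2 (head?_toWord_gen_mul i y)
  have b := or_iff_not_imp_left.2 (head?_toWord_gen_mul j z)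
  have a' := or_iff_not_imp_left.2 (head?_toWord_gen_mul i' y)
  have b' := or_iff_not_imp_left.2 (head?_toWord_gen_mul j' z)
  simp only [cancelType, if_neg hij, if_neg hij'] at h h' hh
  grind

/-- The kernel dominating the overlap coefficients, one tensor factor at a time. -/
def overlapKernel (i j : ℕ) (y z : FG) : ℝ :=
  if i = j then 1 else if cancelType i j (gen i * y) = cancelType i j (gen j * z) then 3 else 0

lemma overlapKernel_nonneg (i j : ℕ) (y z : FG) : 0 ≤ overlapKernel i j y z := by
  unfold overlapKernel; split_ifs <;> norm_num

lemma sum_overlapKernel_le (N : ℕ) (y z : FG) :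
    ∑ i : Fin N, ∑ j : Fin N, overlapKernel i j y z ≤ N + 9 := by
  classical
  set P : Finset (Fin N × Fin N) := Finset.univ.filter fun p =>
    p.1 ≠ p.2 ∧ cancelType p.1 p.2 (gen p.1 * y) = cancelType p.1 p.2 (gen p.2 * z) with hP
  have hcard : P.card ≤ 3 := by
    have := Finset.card_le_card_of_injOn (s := P) (t := (Finset.univ : Finset (Fin 3)))
      (fun p => cancelType p.1 p.2 (gen p.1 * y)) (fun _ _ => Finset.mem_coe.2 (Finset.mem_univ _))
      (by
        rintro ⟨i, j⟩ hp ⟨i', j'⟩ hp' hh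
        simp only [hP, Finset.coe_filter, Finset.mem_univ, true_and, Set.mem_ofPred_eq] at hp hp'
        obtain ⟨h1, h2⟩ := eq_of_cancelType_eq (fun h => hp.1 (Fin.ext h))
          (fun h => hp'.1 (Fin.ext h)) hp.2 hp'.2 hh
        exact Prod.ext (Fin.ext h1) (Fin.ext h2))
    simpa using this
  have hk : ∀ p : Fin N × Fin N, overlapKernel p.1 p.2 y z =
      (if p.1 = p.2 then 1 else 0) + (if p ∈ P then 3 else 0) := by
    rintro ⟨i, j⟩
    by_cases hij : i = j
    · simp [overlapKernel, hP, hij]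
    · have : (i : ℕ) ≠ j := fun h => hij (Fin.ext h)
      simp [overlapKernel, hP, hij, this]
  rw [← Fintype.sum_prod_type' (f := fun i j : Fin N => overlapKernel i j y z)]
  simp_rw [hk, Finset.sum_add_distrib]
  have h1 : ∑ p : Fin N × Fin N, (if p.1 = p.2 then (1 : ℝ) else 0) = N := by
    rw [Fintype.sum_prod_type]; simp
  have h2 : ∑ p : Fin N × Fin N, (if p ∈ P then (3 : ℝ) else 0) = 3 * P.card := by
    simp [mul_comm]
  rw [h1, h2]
  have : (P.card : ℝ) ≤ 3 := by exact_mod_cast hcard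
  linarith

lemma sum_prod_overlapKernel_le (N k : ℕ) (y z : Fin k → FG) :
    ∑ w : Fin k → Fin N, ∑ v : Fin k → Fin N, ∏ l, overlapKernel (w l) (v l) (y l) (z l)
      ≤ ((N : ℝ) + 9) ^ k := by
  classical
  have h1 : ∀ w : Fin k → Fin N,
      ∑ v : Fin k → Fin N, ∏ l, overlapKernel (w l) (v l) (y l) (z l) =
        ∏ l, ∑ j : Fin N, overlapKernel (w l) j (y l) (z l) := fun w => by
    rw [Finset.prod_univ_sum, Fintype.piFinset_univ]
  simp_rw [h1]
  have h2 := Finset.prod_univ_sum (fun _ : Fin k => (Finset.univ : Finset (Fin N)))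
    (fun l i => ∑ j : Fin N, overlapKernel i j (y l) (z l))
  rw [Fintype.piFinset_univ] at h2
  rw [← h2]
  calc _ ≤ ∏ _l : Fin k, ((N : ℝ) + 9) :=
        Finset.prod_le_prod
          (fun l _ => Finset.sum_nonneg fun i _ => Finset.sum_nonneg fun j _ =>
            overlapKernel_nonneg _ _ _ _)
          (fun l _ => sum_overlapKernel_le N (y l) (z l))
    _ = _ := by simp

/-- Cauchy–Schwarz on each fibre of `τ`. -/
lemma sq_sum_mul_le_card_mul {X T : Type*} [DecidableEq T] (s : Finset X) (S : Finset T)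
    (τ : X → T) (hτ : ∀ x ∈ s, τ x ∈ S) (a b : X → ℝ) :
    (∑ x ∈ s, a x * b x) ^ 2 ≤
      S.card * ∑ x ∈ s, ∑ y ∈ s, if τ x = τ y then a x ^ 2 * b y ^ 2 else 0 := by
  rw [← Finset.sum_fiberwise_of_maps_to hτ]
  refine sq_sum_le_card_mul_sum_sq.trans (mul_le_mul_of_nonneg_left ?_ (Nat.cast_nonneg _))
  rw [← Finset.sum_fiberwise_of_maps_to hτ (fun x => ∑ y ∈ s, _)]
  refine Finset.sum_le_sum fun t _ => (Finset.sum_mul_sq_le_sq_mul_sq _ _ _).trans_eq ?_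
  rw [Finset.sum_mul]
  refine Finset.sum_congr rfl fun x hx => ?_
  rw [(Finset.mem_filter.1 hx).2, Finset.mul_sum, Finset.sum_filter]
  exact Finset.sum_congr rfl fun y _ => by simp only [eq_comm]

end Combinatorics

section Overlaps

variable {N k : ℕ}

/-- Left translation of `F_∞^k` by the inverse of `(g_{v_1}, …, g_{v_k})`. -/
def shiftEquiv (v : Fin k → Fin N) : (Fin k → FG) ≃ (Fin k → FG) :=
  Equiv.piCongrRight fun j => Equiv.mulLeft (gen (v j : ℕ))⁻¹

@[simp]
lemma shiftEquiv_apply (v : Fin k → Fin N) (x : Fin k → FG) :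
    shiftEquiv v x = fun j => (gen (v j : ℕ))⁻¹ * x j := rfl

lemma card_mul_ite_le_prod_overlapKernel (w v : Fin k → Fin N) (x y : Fin k → FG) :
    (((Fintype.piFinset fun j => if w j = v j then {0} else Finset.univ :
        Finset (Fin k → Fin 3)).card : ℝ) *
      if (fun j => cancelType (w j) (v j) (x j)) = (fun j => cancelType (w j) (v j) (y j))
        then 1 else 0) ≤
      ∏ j, overlapKernel (w j) (v j) (shiftEquiv w x j) (shiftEquiv v y j) := by
  split_ifs with h
  · rw [Fintype.card_piFinset, mul_one]
    push_cast
    refine (Finset.prod_congr rfl fun j _ => ?_).le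
    have hj := congrFun h j
    by_cases hwv : w j = v j
    · simp [overlapKernel, hwv]
    · have : (w j : ℕ) ≠ v j := fun h => hwv (Fin.ext h)
      simp only [hwv, overlapKernel, this, shiftEquiv_apply, mul_inv_cancel_left, hj, if_true,
        if_false, Finset.card_univ, Fintype.card_fin]
      norm_num
  · rw [mul_zero]
    exact Finset.prod_nonneg fun j _ => overlapKernel_nonneg _ _ _ _

lemma sq_sum_overlap_le (ξ : (Fin k → FG) → ℂ) (s : Finset (Fin k → FG)) (w v : Fin k → Fin N) :
    (∑ x ∈ s, ‖ξ (shiftEquiv w x)‖ * ‖ξ (shiftEquiv v x)‖) ^ 2 ≤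
      ∑ x ∈ s, ∑ y ∈ s, ‖ξ (shiftEquiv w x)‖ ^ 2 * ‖ξ (shiftEquiv v y)‖ ^ 2 *
        ∏ j, overlapKernel (w j) (v j) (shiftEquiv w x j) (shiftEquiv v y j) := by
  classical
  refine (sq_sum_mul_le_card_mul s
    (Fintype.piFinset fun j => if w j = v j then {0} else Finset.univ)
    (fun x j => cancelType (w j) (v j) (x j)) (fun x _ => ?_) _ _).trans ?_
  · rw [Fintype.mem_piFinset]
    intro j
    split_ifs with h
    · simp [h, cancelType_self]
    · simp
  · rw [Finset.mul_sum]
    refine Finset.sum_le_sum fun x _ => ?_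
    rw [Finset.mul_sum]
    refine Finset.sum_le_sum fun y _ => ?_
    calc _ = ‖ξ (shiftEquiv w x)‖ ^ 2 * ‖ξ (shiftEquiv v y)‖ ^ 2 * (_ * if _ then 1 else 0) := by
          split_ifs <;> ring
      _ ≤ _ := mul_le_mul_of_nonneg_left (card_mul_ite_le_prod_overlapKernel w v x y)
          (by positivity)

lemma sum_sq_sum_overlap_le (ξ : (Fin k → FG) → ℂ)
    (hξ : ∀ Y : Finset (Fin k → FG), ∑ y ∈ Y, ‖ξ y‖ ^ 2 ≤ 1) (s : Finset (Fin k → FG)) :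
    ∑ w : Fin k → Fin N, ∑ v : Fin k → Fin N,
      (∑ x ∈ s, ‖ξ (shiftEquiv w x)‖ * ‖ξ (shiftEquiv v x)‖) ^ 2 ≤ ((N : ℝ) + 9) ^ k := by
  classical
  set Y : Finset (Fin k → FG) :=
    Finset.univ.biUnion fun w : Fin k → Fin N => s.map (shiftEquiv w).toEmbedding with hY
  have hsub : ∀ w : Fin k → Fin N, s.map (shiftEquiv w).toEmbedding ⊆ Y := fun w =>
    Finset.subset_biUnion_of_mem (fun w : Fin k → Fin N => s.map (shiftEquiv w).toEmbedding)
      (Finset.mem_univ w)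
  have hK : ∀ (w v : Fin k → Fin N) (y z : Fin k → FG),
      0 ≤ ∏ j, overlapKernel (w j) (v j) (y j) (z j) := fun w v y z =>
    Finset.prod_nonneg fun j _ => overlapKernel_nonneg _ _ _ _
  have hwv : ∀ w v : Fin k → Fin N,
      (∑ x ∈ s, ‖ξ (shiftEquiv w x)‖ * ‖ξ (shiftEquiv v x)‖) ^ 2 ≤
        ∑ y ∈ Y, ∑ z ∈ Y, ‖ξ y‖ ^ 2 * ‖ξ z‖ ^ 2 *
          ∏ j, overlapKernel (w j) (v j) (y j) (z j) := fun w v => by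
    refine (sq_sum_overlap_le ξ s w v).trans ?_
    calc _ = ∑ y ∈ s.map (shiftEquiv w).toEmbedding, ∑ z ∈ s.map (shiftEquiv v).toEmbedding,
          ‖ξ y‖ ^ 2 * ‖ξ z‖ ^ 2 * ∏ j, overlapKernel (w j) (v j) (y j) (z j) := by
          rw [Finset.sum_map]
          refine Finset.sum_congr rfl fun x _ => ?_
          rw [Finset.sum_map]
          rfl
      _ ≤ ∑ y ∈ s.map (shiftEquiv w).toEmbedding, ∑ z ∈ Y,
          ‖ξ y‖ ^ 2 * ‖ξ z‖ ^ 2 * ∏ j, overlapKernel (w j) (v j) (y j) (z j) :=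
          Finset.sum_le_sum fun y _ => Finset.sum_le_sum_of_subset_of_nonneg (hsub v)
            fun z _ _ => mul_nonneg (by positivity) (hK _ _ _ _)
      _ ≤ _ := Finset.sum_le_sum_of_subset_of_nonneg (hsub w)
            fun y _ _ => Finset.sum_nonneg fun z _ => mul_nonneg (by positivity) (hK _ _ _ _)
  calc _ ≤ ∑ w : Fin k → Fin N, ∑ v : Fin k → Fin N, ∑ y ∈ Y, ∑ z ∈ Y,
        ‖ξ y‖ ^ 2 * ‖ξ z‖ ^ 2 * ∏ j, overlapKernel (w j) (v j) (y j) (z j) :=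
        Finset.sum_le_sum fun w _ => Finset.sum_le_sum fun v _ => hwv w v
    _ = ∑ y ∈ Y, ∑ z ∈ Y, ‖ξ y‖ ^ 2 * ‖ξ z‖ ^ 2 *
        ∑ w : Fin k → Fin N, ∑ v : Fin k → Fin N,
          ∏ j, overlapKernel (w j) (v j) (y j) (z j) := by
        simp_rw [Finset.mul_sum]
        rw [Finset.sum_comm_cycle]
        exact Finset.sum_congr rfl fun y _ => Finset.sum_comm_cycle
    _ ≤ ∑ y ∈ Y, ∑ z ∈ Y, ‖ξ y‖ ^ 2 * ‖ξ z‖ ^ 2 * ((N : ℝ) + 9) ^ k :=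
        Finset.sum_le_sum fun y _ => Finset.sum_le_sum fun z _ =>
          mul_le_mul_of_nonneg_left (sum_prod_overlapKernel_le N k y z) (by positivity)
    _ = (∑ y ∈ Y, ‖ξ y‖ ^ 2) ^ 2 * ((N : ℝ) + 9) ^ k := by
        simp_rw [← Finset.sum_mul, ← Finset.mul_sum, ← Finset.sum_mul, sq]
    _ ≤ 1 * ((N : ℝ) + 9) ^ k := by
        refine mul_le_mul_of_nonneg_right ?_ (by positivity)
        exact pow_le_one₀ (Finset.sum_nonneg fun _ _ => by positivity) (hξ Y)
    _ = _ := one_mul _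

/-- The vector `U_v ξ`. -/
def shiftVec (ξ : l2 k) (v : Fin k → Fin N) : l2 k :=
  ⟨fun x => ξ (shiftEquiv v x), by
    have h := (memℓp_gen_iff (by norm_num)).1 (lp.memℓp ξ)
    exact (memℓp_gen_iff (by norm_num)).2 ((shiftEquiv v).summable_iff.2 h)⟩

lemma shiftVec_apply (ξ : l2 k) (v : Fin k → Fin N) (x : Fin k → FG) :
    shiftVec ξ v x = ξ (shiftEquiv v x) := rfl

lemma hasSum_innerUU (ξ : l2 k) (w v : Fin k → Fin N) :
    HasSum (fun x => (starRingEnd ℂ) (ξ (shiftEquiv w x)) * ξ (shiftEquiv v x))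
      (innerUU ξ w v) := by
  have h := (lp.summable_inner (𝕜 := ℂ) (shiftVec ξ w) (shiftVec ξ v))
  refine Summable.hasSum (h.congr fun x => ?_)
  simp [shiftVec_apply, mul_comm]

lemma innerUU_eq_inner (ξ : l2 k) (w v : Fin k → Fin N) :
    innerUU ξ w v = inner ℂ (shiftVec ξ w) (shiftVec ξ v) := by
  rw [lp.inner_eq_tsum, innerUU]
  exact tsum_congr fun x => by simp [shiftVec_apply, mul_comm]

lemma hasSum_norm_sq (ξ : l2 k) : HasSum (fun x => ‖ξ x‖ ^ 2) (‖ξ‖ ^ 2) := by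
  simpa using lp.hasSum_norm (p := 2) (by norm_num) ξ

lemma innerUU_self (ξ : l2 k) (hξ : ‖ξ‖ = 1) (v : Fin k → Fin N) : innerUU ξ v v = 1 := by
  have h1 : HasSum (fun x => ‖ξ (shiftEquiv v x)‖ ^ 2) (‖ξ‖ ^ 2) :=
    (shiftEquiv v).hasSum_iff.2 (hasSum_norm_sq ξ)
  have h2 : ‖shiftVec ξ v‖ ^ 2 = 1 := by
    rw [(hasSum_norm_sq (shiftVec ξ v)).unique h1, hξ, one_pow]
  rw [innerUU_eq_inner, inner_self_eq_norm_sq_to_K]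
  rw [← RCLike.ofReal_pow, h2, RCLike.ofReal_one]

lemma sum_norm_innerUU_sq_le (ξ : l2 k) (hξ : ‖ξ‖ = 1) :
    ∑ w : Fin k → Fin N, ∑ v : Fin k → Fin N, ‖innerUU ξ w v‖ ^ 2 ≤ ((N : ℝ) + 9) ^ k := by
  have hlim : Tendsto (fun s : Finset (Fin k → FG) =>
      ∑ w : Fin k → Fin N, ∑ v : Fin k → Fin N,
        ‖∑ x ∈ s, (starRingEnd ℂ) (ξ (shiftEquiv w x)) * ξ (shiftEquiv v x)‖ ^ 2) atTop
      (nhds (∑ w : Fin k → Fin N, ∑ v : Fin k → Fin N, ‖innerUU ξ w v‖ ^ 2)) :=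
    tendsto_finsetSum _ fun w _ => tendsto_finsetSum _ fun v _ =>
      (hasSum_innerUU ξ w v).norm.pow 2
  refine le_of_tendsto' hlim fun s => ?_
  refine le_trans ?_ (sum_sq_sum_overlap_le (N := N) (fun x => ξ x) (fun Y => ?_) s)
  · refine Finset.sum_le_sum fun w _ => Finset.sum_le_sum fun v _ => ?_
    gcongr
    refine (norm_sum_le _ _).trans_eq ?_
    simp
  · have := sum_le_hasSum Y (fun _ _ => by positivity) (hasSum_norm_sq ξ)
    simpa [hξ] using this

end Overlaps

section Entropy

open scoped ComplexOrder

variable {n : Type*} [Fintype n] [DecidableEq n]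

lemma Matrix.IsHermitian.sum_eigenvalues_sq {M : Matrix n n ℂ} (h : M.IsHermitian) :
    ∑ i, h.eigenvalues i ^ 2 = ∑ i, ∑ j, ‖M i j‖ ^ 2 := by
  have h1 : (M * M).trace = ∑ i, (h.eigenvalues i : ℂ) ^ 2 := by
    conv_lhs => rw [h.spectral_theorem, ← map_mul, Unitary.conjStarAlgAut_apply,
      Matrix.trace_mul_comm, ← mul_assoc]
    simp [Matrix.diagonal_mul_diagonal, Matrix.trace_diagonal, sq]
  have h2 : (M * M).trace = ∑ i, ∑ j, ((‖M i j‖ ^ 2 : ℝ) : ℂ) := by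
    simp only [Matrix.trace, Matrix.diag, Matrix.mul_apply]
    refine Finset.sum_congr rfl fun i _ => Finset.sum_congr rfl fun j _ => ?_
    rw [← h.apply j i, Complex.ofReal_pow]
    exact Complex.mul_conj' _
  exact_mod_cast h1.symm.trans h2

lemma Matrix.IsHermitian.sum_eigenvalues_eq_one {M : Matrix n n ℂ} (h : M.IsHermitian)
    (htr : M.trace = 1) : ∑ i, h.eigenvalues i = 1 := by
  have := h.trace_eq_sum_eigenvalues
  rw [htr, ← RCLike.ofReal_sum, ← RCLike.ofReal_one] at this
  exact (RCLike.ofReal_injective this).symm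

/-- Von Neumann entropy dominates collision entropy. -/
lemma neg_log_le_vnEntropy {M : Matrix n n ℂ} (hM : M.PosSemidef) (htr : M.trace = 1) {q : ℝ}
    (hq : 0 < q) (hMq : ∑ i, ∑ j, ‖M i j‖ ^ 2 ≤ q) : -Real.log q ≤ vnEntropy M := by
  have hH := hM.isHermitian
  have hsum := hH.sum_eigenvalues_eq_one htr
  rw [vnEntropy, dif_pos hH]
  have key : ∀ i, (1 - Real.log q) * hH.eigenvalues i - hH.eigenvalues i ^ 2 / q ≤
      Real.negMulLog (hH.eigenvalues i) := fun i => by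
    rcases (hM.eigenvalues_nonneg i).eq_or_lt with h0 | h0
    · simp [← h0]
    · have := Real.log_le_sub_one_of_pos (div_pos h0 hq)
      rw [Real.log_div h0.ne' hq.ne'] at this
      have := mul_le_mul_of_nonneg_left this h0.le
      have e : hH.eigenvalues i * (hH.eigenvalues i / q - 1) =
        hH.eigenvalues i ^ 2 / q - hH.eigenvalues i := by ring
      rw [Real.negMulLog]
      linarith
  have := Finset.sum_le_sum fun i (_ : i ∈ Finset.univ) => key i
  rw [Finset.sum_sub_distrib, ← Finset.mul_sum, ← Finset.sum_div, hsum, hH.sum_eigenvalues_sq]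
    at this
  have : (∑ i, ∑ j, ‖M i j‖ ^ 2) / q ≤ 1 := (div_le_one hq).2 hMq
  linarith

lemma vnEntropy_le_log_card [Nonempty n] {M : Matrix n n ℂ} (hM : M.PosSemidef)
    (htr : M.trace = 1) : vnEntropy M ≤ Real.log (Fintype.card n) := by
  have hH := hM.isHermitian
  have hsum := hH.sum_eigenvalues_eq_one htr
  have hc : (0 : ℝ) < Fintype.card n := by exact_mod_cast Fintype.card_pos
  rw [vnEntropy, dif_pos hH]
  have key : ∀ i, Real.negMulLog (hH.eigenvalues i) ≤
      (Real.log (Fintype.card n) - 1) * hH.eigenvalues i + (Fintype.card n : ℝ)⁻¹ := fun i => by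
    rcases (hM.eigenvalues_nonneg i).eq_or_lt with h0 | h0
    · simp [← h0]
    · have := Real.log_le_sub_one_of_pos (inv_pos.2 (mul_pos hc h0))
      rw [Real.log_inv, Real.log_mul hc.ne' h0.ne'] at this
      have := mul_le_mul_of_nonneg_left this h0.le
      have e : hH.eigenvalues i * ((Fintype.card n * hH.eigenvalues i)⁻¹ - 1) =
        (Fintype.card n : ℝ)⁻¹ - hH.eigenvalues i := by field_simp
      rw [Real.negMulLog]
      linarith
  have := Finset.sum_le_sum fun i (_ : i ∈ Finset.univ) => key i
  rw [Finset.sum_add_distrib, ← Finset.mul_sum, hsum] at this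
  simp only [Finset.sum_const, Finset.card_univ, nsmul_eq_mul, mul_inv_cancel₀ hc.ne'] at this
  linarith

end Entropy

section MinOutEntropy

open scoped ComplexOrder

variable {N k : ℕ}

lemma Gmat_posSemidef (ξ : l2 k) : (Gmat N k ξ).PosSemidef := by
  have h : Gmat N k ξ =
      ((N : ℂ) ^ k)⁻¹ • (Matrix.gram ℂ (shiftVec ξ : (Fin k → Fin N) → l2 k)).transpose := by
    ext v w
    simp [Gmat, Matrix.gram, innerUU_eq_inner]
  rw [h]
  refine (Matrix.posSemidef_gram ℂ _).transpose.smul ?_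
  simp

lemma trace_Gmat (hN : N ≠ 0) (ξ : l2 k) (hξ : ‖ξ‖ = 1) : (Gmat N k ξ).trace = 1 := by
  simp [Matrix.trace, Gmat, innerUU_self ξ hξ, hN]

lemma sum_norm_Gmat_sq_le (ξ : l2 k) (hξ : ‖ξ‖ = 1) :
    ∑ v, ∑ w, ‖Gmat N k ξ v w‖ ^ 2 ≤ (((N : ℝ) + 9) / N ^ 2) ^ k := by
  have h := sum_norm_innerUU_sq_le (N := N) ξ hξ
  rw [Finset.sum_comm] at h
  simp only [Gmat, Matrix.of_apply, norm_mul, mul_pow, ← Finset.mul_sum]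
  refine (mul_le_mul_of_nonneg_left h (by positivity)).trans_eq ?_
  simp only [norm_inv, norm_pow, Complex.norm_natCast]
  rw [div_pow, div_eq_inv_mul, inv_pow, pow_right_comm]

lemma le_vnEntropy_Gmat (hN : N ≠ 0) (ξ : l2 k) (hξ : ‖ξ‖ = 1) :
    k * (Real.log N - Real.log (1 + 9 / (N : ℝ))) ≤ vnEntropy (Gmat N k ξ) := by
  have hN' : (0 : ℝ) < N := by exact_mod_cast Nat.pos_of_ne_zero hN
  refine le_trans (le_of_eq ?_) (neg_log_le_vnEntropy (Gmat_posSemidef ξ) (trace_Gmat hN ξ hξ)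
    (by positivity) (sum_norm_Gmat_sq_le ξ hξ))
  have e : 1 + 9 / (N : ℝ) = (N + 9) / N := by field_simp
  rw [e, Real.log_pow, Real.log_div (by positivity) hN'.ne', Real.log_div (by positivity)
    (by positivity), Real.log_pow]
  push_cast
  ring

lemma exists_norm_eq_one (k : ℕ) : ∃ ξ : l2 k, ‖ξ‖ = 1 := by
  classical
  exact ⟨lp.single 2 1 (1 : ℂ), by rw [lp.norm_single (by norm_num)]; simp⟩

lemma le_minOutEntropy (hN : N ≠ 0) :
    k * (Real.log N - Real.log (1 + 9 / (N : ℝ))) ≤ minOutEntropy N k := by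
  obtain ⟨ξ₀, h₀⟩ := exists_norm_eq_one k
  refine le_csInf ⟨_, ξ₀, h₀, rfl⟩ ?_
  rintro _ ⟨ξ, hξ, rfl⟩
  exact le_vnEntropy_Gmat hN ξ hξ

lemma minOutEntropy_le (hN : N ≠ 0) : minOutEntropy N k ≤ k * Real.log N := by
  obtain ⟨ξ₀, h₀⟩ := exists_norm_eq_one k
  have : Nonempty (Fin k → Fin N) := ⟨fun _ => ⟨0, Nat.pos_of_ne_zero hN⟩⟩
  have hb := vnEntropy_le_log_card (Gmat_posSemidef (N := N) ξ₀) (trace_Gmat hN ξ₀ h₀)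
  have hbdd : BddBelow {x : ℝ | ∃ ξ : l2 k, ‖ξ‖ = 1 ∧ x = vnEntropy (Gmat N k ξ)} := by
    refine ⟨k * (Real.log N - Real.log (1 + 9 / (N : ℝ))), ?_⟩
    rintro _ ⟨ξ, hξ, rfl⟩
    exact le_vnEntropy_Gmat hN ξ hξ
  exact (csInf_le hbdd ⟨ξ₀, h₀, rfl⟩).trans (hb.trans_eq (by simp))

lemma minOutEntropy_zero_left (hk : k ≠ 0) : minOutEntropy 0 k = 0 := by
  have : IsEmpty (Fin k → Fin 0) := ⟨fun f => (f ⟨0, Nat.pos_of_ne_zero hk⟩).elim0⟩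
  obtain ⟨ξ₀, h₀⟩ := exists_norm_eq_one k
  have h : {x : ℝ | ∃ ξ : l2 k, ‖ξ‖ = 1 ∧ x = vnEntropy (Gmat 0 k ξ)} = {0} := by
    ext x
    simp only [vnEntropy, Finset.univ_eq_empty, Finset.sum_empty, dite_eq_ite, ite_self,
      Set.mem_ofPred_eq, Set.mem_singleton_iff]
    exact ⟨fun ⟨_, _, h⟩ => h, fun h => ⟨ξ₀, h₀, h⟩⟩
  rw [minOutEntropy, h, csInf_singleton]

end MinOutEntropy

/-- The regularized minimum output entropy of `Φ_N` satisfies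
`liminf_{k→∞} h_k/k ≥ log N − log(1+9/N) ≥ log N − 9/N`. -/
theorem regularized_MOE_lower_bound (N : ℕ) :
    Real.log N - Real.log (1 + 9 / (N : ℝ))
      ≤ liminf (fun k : ℕ => minOutEntropy N k / (k : ℝ)) atTop ∧
    Real.log N - 9 / (N : ℝ) ≤ Real.log N - Real.log (1 + 9 / (N : ℝ)) := by
  constructor
  · rcases eq_or_ne N 0 with rfl | hN
    · have : (fun k : ℕ => minOutEntropy 0 k / (k : ℝ)) =ᶠ[atTop] fun _ => 0 := by
        filter_upwards [eventually_ne_atTop 0] with k hk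
        rw [minOutEntropy_zero_left hk, zero_div]
      rw [liminf_congr this]
      simp
    · refine le_liminf_of_le ?_ ?_
      · refine IsBoundedUnder.isCoboundedUnder_ge ⟨Real.log N, ?_⟩
        rw [eventually_map]
        filter_upwards [eventually_gt_atTop 0] with k hk
        rw [div_le_iff₀' (by exact_mod_cast hk)]
        exact minOutEntropy_le hN
      · filter_upwards [eventually_gt_atTop 0] with k hk
        rw [le_div_iff₀' (by exact_mod_cast hk)]
        exact le_minOutEntropy hN
  · have h : (0 : ℝ) < 1 + 9 / (N : ℝ) := by positivity
    have := Real.log_le_sub_one_of_pos h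
    linarith
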